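/- Let p be a prime, x ∈ ℚ_p nonzero with v_p(x) ≥ 0, and e ∈ ℤ with e > v_p(x). Then the p-adic ball B(x, p^{-e}) is μ-measurable with height measure μ(B(x, p^{-e})) = p^{1-e}/(p+1); that is, the ratio #{r ∈ ℚ : H(r) ≤ T and |r − x|_p ≤ p^{-e}} / #{r ∈ ℚ : H(r) ≤ T} tends to p^{1-e}/(p+1) as T → ∞. -/

import Mathlib

/-- The height of a rational number: for `r = m/n` in lowest terms,
`H(r) = max (|m|, n)`; in particular `H(0) = 1`. -/
def ratHeight (r : ℚ) : ℕ := max r.num.natAbs r.den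

open Filter Finset ArithmeticFunction
open scoped Topology ArithmeticFunction.Moebius

/-- The integral points `(m, n)` with `|m| ≤ T`, `1 ≤ n ≤ T`, `Q n` and `m ≡ a n` modulo `N`. -/
noncomputable def latticePoints (Q : ℕ → Prop) [DecidablePred Q] (N : ℕ) (a : ℤ) (T : ℕ) :
    Finset (ℤ × ℕ) :=
  {z ∈ Icc (-T : ℤ) T ×ˢ Icc 1 T | Q z.2 ∧ (N : ℤ) ∣ z.1 - a * z.2}

/-- The points of `latticePoints Q N a T` with coprime coordinates. -/
noncomputable def coprimePoints (Q : ℕ → Prop) [DecidablePred Q] (N : ℕ) (a : ℤ) (T : ℕ) :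
    Finset (ℤ × ℕ) :=
  {z ∈ latticePoints Q N a T | z.1.natAbs.Coprime z.2}

section Counting

variable {Q : ℕ → Prop} [DecidablePred Q] {N : ℕ} {a : ℤ}

lemma mem_latticePoints {T : ℕ} {z : ℤ × ℕ} : z ∈ latticePoints Q N a T ↔
    (-(T : ℤ) ≤ z.1 ∧ z.1 ≤ T) ∧ (1 ≤ z.2 ∧ z.2 ≤ T) ∧ Q z.2 ∧ (N : ℤ) ∣ z.1 - a * z.2 := by
  simp [latticePoints, and_assoc]

lemma card_filter_dvd_gcd_latticePoints (hQ : ∀ d n, Q (d * n) ↔ Q d ∧ Q n)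
    (hN : ∀ d, Q d → d.Coprime N) {d : ℕ} (hd : 0 < d) (T : ℕ) :
    #{z ∈ latticePoints Q N a T | d ∣ z.1.natAbs.gcd z.2} =
      if Q d then #(latticePoints Q N a (T / d)) else 0 := by
  have hd' : (0 : ℤ) < d := by exact_mod_cast hd
  split_ifs with hQd
  · symm
    refine card_bij (fun z _ => ((d : ℤ) * z.1, d * z.2)) ?_ ?_ ?_
    · rintro ⟨m, n⟩ hz
      simp only [mem_latticePoints, mem_filter] at hz ⊢
      obtain ⟨⟨h1, h2⟩, ⟨h3, h4⟩, h5, h6⟩ := hz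
      have hT : (d : ℤ) * (T / d : ℕ) ≤ T := by exact_mod_cast Nat.mul_div_le T d
      refine ⟨⟨⟨by nlinarith, by nlinarith⟩, ⟨Nat.mul_pos hd h3, ?_⟩, (hQ _ _).2 ⟨hQd, h5⟩, ?_⟩, ?_⟩
      · exact (Nat.mul_le_mul_left d h4).trans (Nat.mul_div_le T d)
      · have : (d : ℤ) * m - a * ((d * n : ℕ) : ℤ) = d * (m - a * n) := by push_cast; ring
        rw [this]
        exact h6.mul_left _
      · refine Nat.dvd_gcd ?_ (dvd_mul_right _ _)
        rw [Int.natAbs_mul, Int.natAbs_natCast]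
        exact dvd_mul_right _ _
    · rintro ⟨m, n⟩ _ ⟨m', n'⟩ _ h
      simp only [Prod.mk.injEq] at h ⊢
      exact ⟨mul_left_cancel₀ hd'.ne' h.1, Nat.eq_of_mul_eq_mul_left hd h.2⟩
    · rintro ⟨m, n⟩ hz
      simp only [mem_latticePoints, mem_filter, Nat.dvd_gcd_iff] at hz
      obtain ⟨⟨⟨h1, h2⟩, ⟨h3, h4⟩, h5, h6⟩, h7, n, rfl⟩ := hz
      rw [← Int.natCast_dvd] at h7
      obtain ⟨m, rfl⟩ := h7
      refine ⟨(m, n), ?_, rfl⟩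
      simp only [mem_latticePoints, Int.natCast_div]
      refine ⟨⟨?_, ?_⟩, ⟨Nat.pos_of_mul_pos_left h3, ?_⟩, ((hQ _ _).1 h5).2, ?_⟩
      · rw [neg_le, Int.le_ediv_iff_mul_le hd']; linarith
      · rw [Int.le_ediv_iff_mul_le hd']; linarith
      · rw [Nat.le_div_iff_mul_le hd]; linarith
      · have : (d : ℤ) * m - a * ((d * n : ℕ) : ℤ) = d * (m - a * n) := by push_cast; ring
        rw [this] at h6
        exact IsCoprime.dvd_of_dvd_mul_left
          (Int.isCoprime_iff_gcd_eq_one.2 (by simpa using (hN d hQd).symm)) h6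
  · rw [card_eq_zero, filter_eq_empty_iff]
    rintro ⟨m, n⟩ hz hdvd
    obtain ⟨k, hk⟩ := hdvd.trans (Nat.gcd_dvd_right _ _)
    have hk : n = d * k := hk
    subst hk
    exact hQd ((hQ _ _).1 (mem_latticePoints.1 hz).2.2.1).1

lemma card_coprimePoints_eq_sum (hQ : ∀ d n, Q (d * n) ↔ Q d ∧ Q n)
    (hN : ∀ d, Q d → d.Coprime N) (T : ℕ) :
    (#(coprimePoints Q N a T) : ℤ) =
      ∑ d ∈ Icc 1 T, if Q d then μ d * #(latticePoints Q N a (T / d)) else 0 := by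
  calc (#(coprimePoints Q N a T) : ℤ)
      = ∑ z ∈ latticePoints Q N a T, ∑ d ∈ Icc 1 T, if d ∣ z.1.natAbs.gcd z.2 then μ d else 0 := by
        rw [coprimePoints, card_filter]
        push_cast
        refine sum_congr rfl fun z hz => ?_
        obtain ⟨-, ⟨h1, h2⟩, -⟩ := mem_latticePoints.1 hz
        have hg : 0 < z.1.natAbs.gcd z.2 := Nat.gcd_pos_of_pos_right _ h1
        have hdiv : {d ∈ Icc 1 T | d ∣ z.1.natAbs.gcd z.2} = (z.1.natAbs.gcd z.2).divisors := by
          ext d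
          simp only [mem_filter, mem_Icc, Nat.mem_divisors]
          refine ⟨fun h => ⟨h.2, hg.ne'⟩, fun h => ⟨⟨Nat.pos_of_dvd_of_pos h.1 hg, ?_⟩, h.1⟩⟩
          exact (Nat.le_of_dvd h1 (h.1.trans (Nat.gcd_dvd_right _ _))).trans h2
        rw [← sum_filter, hdiv, ← coe_mul_zeta_apply, moebius_mul_coe_zeta, one_apply]
    _ = ∑ d ∈ Icc 1 T, ∑ z ∈ latticePoints Q N a T,
          if d ∣ z.1.natAbs.gcd z.2 then μ d else 0 := sum_comm
    _ = _ := by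
        refine sum_congr rfl fun d hd => ?_
        rw [← sum_filter, sum_const,
          card_filter_dvd_gcd_latticePoints hQ hN (mem_Icc.1 hd).1, nsmul_eq_mul]
        split_ifs <;> simp [mul_comm]

lemma abs_card_filter_dvd_sub_le (hN : 0 < N) (c : ℤ) (T : ℕ) :
    |(#{m ∈ Icc (-T : ℤ) T | (N : ℤ) ∣ m - c} : ℝ) - 2 * T / N| ≤ 2 := by
  have hN' : (0 : ℤ) < N := by exact_mod_cast hN
  have hNQ : (1 : ℚ) ≤ N := by exact_mod_cast hN
  have key := Int.Ioc_filter_modEq_card (-T - 1 : ℤ) (T : ℤ) hN' c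
  have hset : {m ∈ Icc (-T : ℤ) T | (N : ℤ) ∣ m - c} =
      {m ∈ Ioc (-T - 1 : ℤ) T | m ≡ c [ZMOD N]} := by
    ext m
    simp only [mem_filter, mem_Icc, mem_Ioc]
    rw [Int.modEq_comm, Int.modEq_iff_dvd]
    exact and_congr_left fun _ => by omega
  have hle : ⌊(((-T - 1 : ℤ) : ℚ) - c) / ((N : ℤ) : ℚ)⌋ ≤ ⌊(((T : ℤ) : ℚ) - c) / ((N : ℤ) : ℚ)⌋ := by
    apply Int.floor_le_floor
    gcongr
    have : (0 : ℚ) ≤ T := by positivity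
    linarith
  rw [← hset, max_eq_left (by linarith)] at key
  have hq : |(#{m ∈ Icc (-T : ℤ) T | (N : ℤ) ∣ m - c} : ℚ) - 2 * T / N| ≤ 2 := by
    have key' : (#{m ∈ Icc (-T : ℤ) T | (N : ℤ) ∣ m - c} : ℚ) =
        ⌊(((T : ℤ) : ℚ) - c) / ((N : ℤ) : ℚ)⌋ - ⌊(((-T - 1 : ℤ) : ℚ) - c) / ((N : ℤ) : ℚ)⌋ := by
      exact_mod_cast key
    rw [key']
    have e1 := Int.floor_le ((((T : ℤ) : ℚ) - c) / ((N : ℤ) : ℚ))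
    have e2 := Int.lt_floor_add_one ((((T : ℤ) : ℚ) - c) / ((N : ℤ) : ℚ))
    have e3 := Int.floor_le ((((-T - 1 : ℤ) : ℚ) - c) / ((N : ℤ) : ℚ))
    have e4 := Int.lt_floor_add_one ((((-T - 1 : ℤ) : ℚ) - c) / ((N : ℤ) : ℚ))
    have e5 : (((T : ℤ) : ℚ) - c) / ((N : ℤ) : ℚ) - (((-T - 1 : ℤ) : ℚ) - c) / ((N : ℤ) : ℚ)
        = 2 * T / N + 1 / N := by push_cast; ring
    have e6 : (0 : ℚ) ≤ 1 / N := by positivity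
    have e7 : (1 : ℚ) / N ≤ 1 := by rw [div_le_one (by linarith)]; exact hNQ
    rw [abs_le]
    constructor <;> linarith
  have hr := (Rat.cast_le (K := ℝ)).2 hq
  push_cast at hr
  exact hr

lemma card_latticePoints_eq_sum (T : ℕ) : #(latticePoints Q N a T) =
    ∑ n ∈ Icc 1 T with Q n, #{m ∈ Icc (-T : ℤ) T | (N : ℤ) ∣ m - a * n} := by
  rw [latticePoints, card_filter, sum_product_right, sum_filter]
  refine sum_congr rfl fun n _ => ?_
  rw [card_filter]
  split_ifs with h <;> simp [h]

lemma card_latticePoints_le (T : ℕ) : (#(latticePoints Q N a T) : ℝ) ≤ 3 * (T : ℝ) ^ 2 := by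
  have h : #(latticePoints Q N a T) ≤ (2 * T + 1) * T := by
    refine (card_filter_le _ _).trans ?_
    rw [card_product, Int.card_Icc, Nat.card_Icc]
    apply Nat.mul_le_mul <;> omega
  have h2 : (2 * T + 1) * T ≤ 3 * T ^ 2 := by
    rcases T.eq_zero_or_pos with rfl | hT
    · simp
    · nlinarith
  exact_mod_cast h.trans h2

lemma tendsto_card_latticePoints_div_sq (hN : 0 < N) {ρ : ℝ}
    (hρ : Tendsto (fun T : ℕ => (#{n ∈ Icc 1 T | Q n} : ℝ) / T) atTop (𝓝 ρ)) :
    Tendsto (fun T : ℕ => (#(latticePoints Q N a T) : ℝ) / (T : ℝ) ^ 2) atTop (𝓝 (2 * ρ / N)) := by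
  have hmain : Tendsto (fun T : ℕ => (#{n ∈ Icc 1 T | Q n} : ℝ) / T * (2 / N)) atTop
      (𝓝 (2 * ρ / N)) := by
    convert hρ.mul_const (2 / (N : ℝ)) using 2
    ring
  have hdiff : Tendsto (fun T : ℕ => (#(latticePoints Q N a T) : ℝ) / (T : ℝ) ^ 2 -
      (#{n ∈ Icc 1 T | Q n} : ℝ) / T * (2 / N)) atTop (𝓝 0) := by
    refine squeeze_zero_norm' ?_ (tendsto_const_div_atTop_nhds_zero_nat 2)
    filter_upwards [eventually_gt_atTop 0] with T hT
    have hT' : (0 : ℝ) < T := by exact_mod_cast hT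
    have hbound : |(#(latticePoints Q N a T) : ℝ) - #{n ∈ Icc 1 T | Q n} * (2 * T / N)| ≤ 2 * T := by
      rw [card_latticePoints_eq_sum]
      push_cast
      rw [← nsmul_eq_mul, ← sum_const, ← sum_sub_distrib]
      refine (abs_sum_le_sum_abs _ _).trans
        ((sum_le_sum fun (n : ℕ) _ => abs_card_filter_dvd_sub_le hN (a * n) T).trans ?_)
      rw [sum_const, nsmul_eq_mul, mul_comm]
      have : #{n ∈ Icc 1 T | Q n} ≤ T := (card_filter_le _ _).trans (by simp)
      gcongr
    have heq : (#(latticePoints Q N a T) : ℝ) / (T : ℝ) ^ 2 -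
        (#{n ∈ Icc 1 T | Q n} : ℝ) / T * (2 / N) =
        ((#(latticePoints Q N a T) : ℝ) - #{n ∈ Icc 1 T | Q n} * (2 * T / N)) / (T : ℝ) ^ 2 := by
      field_simp
    rw [heq, Real.norm_eq_abs, abs_div, abs_of_pos (by positivity : (0 : ℝ) < (T : ℝ) ^ 2),
      div_le_div_iff₀ (by positivity) hT']
    nlinarith
  simpa using hdiff.add hmain

end Counting

lemma tendsto_natCast_div_div_atTop (d : ℕ) :
    Tendsto (fun T : ℕ => ((T / d : ℕ) : ℝ) / T) atTop (𝓝 (1 / d)) := by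
  have h := (tendsto_nat_floor_mul_div_atTop (R := ℝ) (a := 1 / d) (by positivity)).comp
    tendsto_natCast_atTop_atTop
  refine h.congr fun T => ?_
  simp only [Function.comp_apply]
  rw [one_div_mul_eq_div, Nat.floor_div_eq_div]

lemma tendsto_comp_div_div_sq {f : ℕ → ℝ} {c : ℝ}
    (hf : Tendsto (fun T : ℕ => f T / (T : ℝ) ^ 2) atTop (𝓝 c)) {d : ℕ} (hd : 0 < d) :
    Tendsto (fun T : ℕ => f (T / d) / (T : ℝ) ^ 2) atTop (𝓝 (c * (1 / (d : ℝ) ^ 2))) := by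
  have h1 := hf.comp (Nat.tendsto_div_const_atTop hd.ne')
  have h2 := h1.mul ((tendsto_natCast_div_div_atTop d).pow 2)
  rw [div_pow, one_pow] at h2
  refine h2.congr' ?_
  filter_upwards [eventually_ge_atTop d] with T hT
  have : ((T / d : ℕ) : ℝ) ≠ 0 := by exact_mod_cast (Nat.div_pos hT hd).ne'
  simp only [Function.comp_apply]
  field_simp

theorem tendsto_card_coprimePoints_div_sq {Q : ℕ → Prop} [DecidablePred Q] {N : ℕ} {a : ℤ}
    (hQ : ∀ d n, Q (d * n) ↔ Q d ∧ Q n) (hN : 0 < N) (hQN : ∀ d, Q d → d.Coprime N) {ρ : ℝ}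
    (hρ : Tendsto (fun T : ℕ => (#{n ∈ Icc 1 T | Q n} : ℝ) / T) atTop (𝓝 ρ)) :
    Tendsto (fun T : ℕ => (#(coprimePoints Q N a T) : ℝ) / (T : ℝ) ^ 2) atTop
      (𝓝 (2 * ρ / N * ∑' d : ℕ, if Q d then (μ d : ℝ) / (d : ℝ) ^ 2 else 0)) := by
  rw [← tsum_mul_left]
  have hsum (T : ℕ) : (#(coprimePoints Q N a T) : ℝ) / (T : ℝ) ^ 2 =
      ∑' d : ℕ, if Q d then μ d * (#(latticePoints Q N a (T / d)) / (T : ℝ) ^ 2) else 0 := by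
    rw [tsum_eq_sum (s := Icc 1 T)]
    · have h := congrArg (Int.cast : ℤ → ℝ) (card_coprimePoints_eq_sum (a := a) hQ hQN T)
      push_cast at h
      rw [h, sum_div]
      refine sum_congr rfl fun d _ => ?_
      split_ifs <;> ring
    · intro d hd
      have hd' : T / d = 0 := by
        rw [Nat.div_eq_zero_iff]
        simp only [mem_Icc] at hd
        omega
      simp [hd', latticePoints]
  simp_rw [hsum]
  refine tendsto_tsum_of_dominated_convergence (bound := fun d : ℕ => 3 * (1 / (d : ℝ) ^ 2))
    ((Real.summable_one_div_nat_pow.2 one_lt_two).mul_left 3) ?_ ?_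
  · intro d
    rcases d.eq_zero_or_pos with rfl | hd
    · simp
    split_ifs
    · convert (tendsto_comp_div_div_sq (tendsto_card_latticePoints_div_sq (a := a) hN hρ)
        hd).const_mul (μ d : ℝ) using 2
      ring
    · simp
  · filter_upwards [eventually_gt_atTop 0] with T hT d
    have hT' : (0 : ℝ) < T := by exact_mod_cast hT
    split_ifs
    · rw [norm_mul, norm_div, Real.norm_natCast, norm_pow, Real.norm_natCast]
      have h1 : ‖(μ d : ℝ)‖ ≤ 1 := by
        rw [Real.norm_eq_abs]; exact_mod_cast abs_moebius_le_one
      have h2 : (#(latticePoints Q N a (T / d)) : ℝ) / (T : ℝ) ^ 2 ≤ 3 * (1 / (d : ℝ) ^ 2) := by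
        rw [div_le_iff₀ (by positivity)]
        refine (card_latticePoints_le _).trans ?_
        have h3 : ((T / d : ℕ) : ℝ) ≤ T / d := Nat.cast_div_le
        calc 3 * ((T / d : ℕ) : ℝ) ^ 2 ≤ 3 * ((T : ℝ) / d) ^ 2 := by gcongr
          _ = _ := by ring
      calc _ ≤ 1 * (3 * (1 / (d : ℝ) ^ 2)) := by gcongr
        _ = _ := one_mul _
    · rw [norm_zero]; positivity
lemma summable_moebius_div_sq : Summable fun d : ℕ => (μ d : ℝ) / (d : ℝ) ^ 2 := by
  refine .of_norm_bounded (Real.summable_one_div_nat_pow.2 one_lt_two) fun d => ?_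
  rw [norm_div, norm_pow, Real.norm_natCast, Real.norm_eq_abs]
  gcongr
  exact_mod_cast abs_moebius_le_one

lemma tsum_moebius_div_sq_ne_zero : ∑' d : ℕ, (μ d : ℝ) / (d : ℝ) ^ 2 ≠ 0 := by
  intro h
  have h1 := LSeries_zeta_mul_Lseries_moebius (s := 2) (by norm_num)
  have h2 : LSeries (fun n => ((μ n : ℤ) : ℂ)) 2 = ((∑' d : ℕ, (μ d : ℝ) / (d : ℝ) ^ 2 : ℝ) : ℂ) := by
    rw [LSeries, Complex.ofReal_tsum]
    refine tsum_congr fun d => ?_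
    rcases eq_or_ne d 0 with rfl | hd
    · simp
    · rw [LSeries.term_of_ne_zero hd]
      push_cast
      norm_cast
  rw [h2, h] at h1
  simp at h1

lemma tsum_moebius_div_sq_eq_mul {p : ℕ} (hp : p.Prime) :
    ∑' d : ℕ, (μ d : ℝ) / (d : ℝ) ^ 2 =
      (1 - 1 / (p : ℝ) ^ 2) * ∑' d : ℕ, if ¬ p ∣ d then (μ d : ℝ) / (d : ℝ) ^ 2 else 0 := by
  set f : ℕ → ℝ := fun d => (μ d : ℝ) / (d : ℝ) ^ 2 with hf
  have hsum : Summable f := summable_moebius_div_sq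
  have h1 : Summable fun d => if ¬ p ∣ d then f d else 0 := by
    exact (hsum.indicator {d | ¬ p ∣ d}).congr fun d => by simp [Set.indicator_apply]
  have h2 : Summable fun d => if p ∣ d then f d else 0 := by
    exact (hsum.indicator {d | p ∣ d}).congr fun d => by simp [Set.indicator_apply]
  have hsplit : ∑' d, f d = (∑' d, if ¬ p ∣ d then f d else 0) + ∑' d, if p ∣ d then f d else 0 := by
    rw [← h1.tsum_add h2]
    refine tsum_congr fun d => ?_
    by_cases h : p ∣ d <;> simp [h]
  have hmul : ∑' d, (if p ∣ d then f d else 0) = ∑' k, f (p * k) := by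
    rw [← (mul_right_injective₀ hp.ne_zero).tsum_eq (f := fun d => if p ∣ d then f d else 0)]
    · simp
    · intro d hd
      simp only [Function.mem_support, ne_eq, ite_eq_right_iff, not_forall] at hd
      obtain ⟨⟨k, rfl⟩, -⟩ := hd
      exact ⟨k, rfl⟩
  have hterm (k : ℕ) : f (p * k) = -(1 / (p : ℝ) ^ 2) * if ¬ p ∣ k then f k else 0 := by
    by_cases hk : p ∣ k
    · have : ¬ Squarefree (p * k) := fun h =>
        hp.not_isUnit (h p (mul_dvd_mul_left p hk))
      simp [hf, hk, moebius_eq_zero_of_not_squarefree this]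
    · have hcop : p.Coprime k := (Nat.Prime.coprime_iff_not_dvd hp).2 hk
      simp only [hf, hk, not_false_eq_true, if_true,
        isMultiplicative_moebius.map_mul_of_coprime hcop, moebius_apply_prime hp]
      push_cast
      ring
  rw [hsplit, hmul, tsum_congr hterm, tsum_mul_left]
  ring

lemma tendsto_card_filter_not_dvd_div {p : ℕ} :
    Tendsto (fun T : ℕ => (#{n ∈ Icc 1 T | ¬ p ∣ n} : ℝ) / T) atTop (𝓝 (1 - 1 / p)) := by
  have h : Tendsto (fun T : ℕ => 1 - ((T / p : ℕ) : ℝ) / T) atTop (𝓝 (1 - 1 / p)) :=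
    (tendsto_natCast_div_div_atTop p).const_sub 1
  refine h.congr' ?_
  filter_upwards [eventually_gt_atTop 0] with T hT
  have hT' : (T : ℝ) ≠ 0 := by exact_mod_cast hT.ne'
  have h1 := card_filter_add_card_filter_not (s := Icc 1 T) (p ∣ ·)
  have h2 : #{n ∈ Icc 1 T | p ∣ n} = T / p := Nat.Ioc_filter_dvd_card_eq_div T p
  rw [h2, Nat.card_Icc, Nat.add_sub_cancel] at h1
  have h3 : ((T / p : ℕ) : ℝ) + #{n ∈ Icc 1 T | ¬ p ∣ n} = T := by exact_mod_cast h1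
  rw [eq_div_iff hT', sub_mul, div_mul_cancel₀ _ hT']
  linarith

lemma natCard_rat_eq_card_coprimePoints {Q : ℕ → Prop} [DecidablePred Q] {N : ℕ} {a : ℤ}
    {P : ℚ → Prop} (hP : ∀ r : ℚ, P r ↔ Q r.den ∧ (N : ℤ) ∣ r.num - a * r.den) (T : ℕ) :
    Nat.card {r : ℚ // ratHeight r ≤ T ∧ P r} = #(coprimePoints Q N a T) := by
  rw [← Nat.card_eq_finsetCard]
  have hmem (z : ℤ × ℕ) : z ∈ coprimePoints Q N a T ↔ ((-(T : ℤ) ≤ z.1 ∧ z.1 ≤ T) ∧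
      (1 ≤ z.2 ∧ z.2 ≤ T) ∧ Q z.2 ∧ (N : ℤ) ∣ z.1 - a * z.2) ∧ z.1.natAbs.Coprime z.2 := by
    rw [coprimePoints, mem_filter, mem_latticePoints]
  refine Nat.card_congr
    { toFun r := ⟨(r.1.num, r.1.den), ?_⟩
      invFun z := ⟨⟨z.1.1, z.1.2, ?_, ?_⟩, ?_⟩
      left_inv r := rfl
      right_inv z := rfl }
  · obtain ⟨r, hr, hPr⟩ := r
    rw [ratHeight, max_le_iff] at hr
    rw [hmem]
    exact ⟨⟨by dsimp only; omega, ⟨r.den_pos, hr.2⟩, (hP r).1 hPr⟩, r.reduced⟩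
  · have := (hmem z.1).1 z.2
    omega
  · exact ((hmem z.1).1 z.2).2
  · obtain ⟨⟨h1, h2, h3⟩, -⟩ := (hmem z.1).1 z.2
    rw [hP, ratHeight, max_le_iff]
    exact ⟨⟨by dsimp only; omega, h2.2⟩, h3⟩

lemma norm_ratCast_sub_natCast_le_iff {p : ℕ} [hp : Fact p.Prime] {k : ℕ} (hk : k ≠ 0) (a : ℤ)
    (r : ℚ) : ‖(r : ℚ_[p]) - a‖ ≤ (p : ℝ) ^ (-k : ℤ) ↔
      ¬ p ∣ r.den ∧ ((p ^ k : ℕ) : ℤ) ∣ r.num - a * r.den := by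
  have hden : (r.den : ℚ_[p]) ≠ 0 := by exact_mod_cast r.den_ne_zero
  have heq : (r : ℚ_[p]) - a = ((r.num - a * r.den : ℤ) : ℚ_[p]) / (r.den : ℚ_[p]) := by
    rw [eq_div_iff hden, sub_mul]
    push_cast
    congr 1
    exact_mod_cast Rat.mul_den_eq_num r
  rw [Nat.cast_pow, ← Padic.norm_int_le_pow_iff_dvd, heq, norm_div]
  by_cases h : p ∣ r.den
  · simp only [h, not_true_eq_false, false_and, iff_false, not_le]
    have hp1 : (p : ℝ) ^ (-k : ℤ) < 1 := by
      rw [zpow_neg, zpow_natCast]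
      exact inv_lt_one_of_one_lt₀ (one_lt_pow₀ (by exact_mod_cast hp.out.one_lt) hk)
    refine hp1.trans_le ?_
    have hnum : ‖((r.num - a * r.den : ℤ) : ℚ_[p])‖ = 1 := by
      refine le_antisymm (Padic.norm_int_le_one _) (not_lt.1 fun hlt => ?_)
      rw [Padic.norm_intCast_lt_one_iff] at hlt
      have hpd : (p : ℤ) ∣ r.num :=
        (dvd_sub_left ((Int.natCast_dvd_natCast.2 h).mul_left a)).1 hlt
      exact Nat.not_coprime_of_dvd_of_dvd hp.out.one_lt (Int.natCast_dvd.1 hpd) h r.reduced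
    rw [hnum]
    refine (one_le_div (norm_pos_iff.2 hden)).2 ?_
    exact_mod_cast Padic.norm_int_le_one (p := p) r.den
  · have h1 : ‖(r.den : ℚ_[p])‖ = 1 :=
      Padic.norm_natCast_eq_one_iff.2 ((Nat.Prime.coprime_iff_not_dvd hp.out).2 h)
    rw [h1, div_one]
    simp [h]

lemma exists_norm_sub_le_iff {p : ℕ} [hp : Fact p.Prime] {x : ℚ_[p]} (hx : ‖x‖ ≤ 1) (k : ℕ) :
    ∃ a : ℤ, ∀ y : ℚ_[p], ‖y - x‖ ≤ (p : ℝ) ^ (-k : ℤ) ↔ ‖y - a‖ ≤ (p : ℝ) ^ (-k : ℤ) := by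
  obtain ⟨x, rfl⟩ : ∃ z : ℤ_[p], (z : ℚ_[p]) = x := ⟨⟨x, hx⟩, rfl⟩
  refine ⟨(x.appr k : ℕ), fun y => ?_⟩
  have h : ‖(x : ℚ_[p]) - ((x.appr k : ℕ) : ℤ)‖ ≤ (p : ℝ) ^ (-k : ℤ) := by
    have := (PadicInt.norm_le_pow_iff_mem_span_pow _ k).2 (x.appr_spec k)
    rw [PadicInt.norm_def] at this
    push_cast at this ⊢
    exact this
  constructor <;> intro h'
  · rw [← sub_add_sub_cancel y (x : ℚ_[p])]
    exact (IsUltrametricDist.norm_add_le_max _ _).trans (max_le h' h)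
  · rw [← sub_add_sub_cancel y (((x.appr k : ℕ) : ℤ) : ℚ_[p])]
    exact (IsUltrametricDist.norm_add_le_max _ _).trans (max_le h' ((norm_sub_rev _ _).trans_le h))

/-- For a prime `p`, a nonzero `x ∈ ℚ_p` with `v_p(x) ≥ 0` and `e ∈ ℤ` with
`e > v_p(x)`, the proportion of rationals of height at most `T` lying in the
closed ball `B(x, p^{-e})` tends to `p^{1-e}/(p+1)`. -/
theorem ball_height_measure_of_gt_val_nonneg
    (p : ℕ) [hp : Fact p.Prime] (x : ℚ_[p]) (hx : x ≠ 0) (e : ℤ)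
    (hvx : 0 ≤ x.valuation) (he : x.valuation < e) :
    Filter.Tendsto
      (fun T : ℕ =>
        (Nat.card {r : ℚ // ratHeight r ≤ T ∧ ‖(r : ℚ_[p]) - x‖ ≤ (p : ℝ) ^ (-e)} : ℝ) /
        (Nat.card {r : ℚ // ratHeight r ≤ T} : ℝ))
      Filter.atTop (nhds ((p : ℝ) ^ (1 - e) / ((p : ℝ) + 1))) := by
  lift e to ℕ using by omega
  have he0 : e ≠ 0 := by omega
  have hp1 : (1 : ℝ) < p := by exact_mod_cast hp.out.one_lt
  obtain ⟨a, ha⟩ := exists_norm_sub_le_iff ((Padic.norm_le_one_iff_val_nonneg x).2 hvx) e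
  have hball (T : ℕ) :
      Nat.card {r : ℚ // ratHeight r ≤ T ∧ ‖(r : ℚ_[p]) - x‖ ≤ (p : ℝ) ^ (-e : ℤ)} =
        #(coprimePoints (¬ p ∣ ·) (p ^ e) a T) :=
    natCard_rat_eq_card_coprimePoints
      (fun r => (ha r).trans (norm_ratCast_sub_natCast_le_iff he0 a r)) T
  have htot (T : ℕ) : Nat.card {r : ℚ // ratHeight r ≤ T} =
      #(coprimePoints (fun _ => True) 1 0 T) := by
    rw [← natCard_rat_eq_card_coprimePoints (P := fun _ => True) (by simp)]
    simp
  have hlim₁ := tendsto_card_coprimePoints_div_sq (Q := (¬ p ∣ ·)) (N := p ^ e) (a := a)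
    (fun d n => by rw [hp.out.dvd_mul, not_or]) (pow_pos hp.out.pos e)
    (fun d hd => ((Nat.Prime.coprime_iff_not_dvd hp.out).2 hd).symm.pow_right e)
    tendsto_card_filter_not_dvd_div
  have hlim₂ := tendsto_card_coprimePoints_div_sq (Q := fun _ => True) (N := 1) (a := 0) (ρ := 1)
    (by simp) one_pos (by simp) (by
      refine tendsto_const_nhds.congr' ?_
      filter_upwards [eventually_gt_atTop 0] with T hT
      have hT' : (T : ℝ) ≠ 0 := by exact_mod_cast hT.ne'
      simp [hT'])
  simp only [if_true] at hlim₂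
  have hne := tsum_moebius_div_sq_ne_zero
  have hlim := hlim₁.div hlim₂ (by simpa using hne)
  simp_rw [hball, htot]
  rw [tsum_moebius_div_sq_eq_mul hp.out] at hlim hne
  have hM := right_ne_zero_of_mul hne
  have hconst : (p : ℝ) ^ (1 - e : ℤ) / ((p : ℝ) + 1) =
      2 * (1 - 1 / (p : ℝ)) / ((p ^ e : ℕ) : ℝ) *
        (∑' d : ℕ, if ¬ p ∣ d then (μ d : ℝ) / (d : ℝ) ^ 2 else 0) /
      (2 * 1 / ((1 : ℕ) : ℝ) * ((1 - 1 / (p : ℝ) ^ 2) *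
        ∑' d : ℕ, if ¬ p ∣ d then (μ d : ℝ) / (d : ℝ) ^ 2 else 0)) := by
    have h0 : (p : ℝ) ≠ 0 := by linarith
    have h1 : (p : ℝ) - 1 ≠ 0 := by linarith
    have h2 : (p : ℝ) + 1 ≠ 0 := by linarith
    have h3 : (1 : ℝ) - 1 / (p : ℝ) ^ 2 = (p - 1) * (p + 1) / (p : ℝ) ^ 2 := by field_simp; ring
    rw [zpow_sub₀ h0, zpow_one, zpow_natCast, h3]
    push_cast
    field_simp
  rw [hconst]
  refine hlim.congr' ?_
  filter_upwards [eventually_gt_atTop 0] with T hT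
  have hT' : (T : ℝ) ≠ 0 := by exact_mod_cast hT.ne'
  simp only [Pi.div_apply]
  rw [div_div_div_cancel_right₀ (pow_ne_zero 2 hT')]
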